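/- The weak* limits (φ̄₂, θ̄₂, ȳ₂, p̄₂) of the second-order residuals satisfy the inhomogeneous linear ODE system: dφ̄₂/dt = ω'(y₀)ȳ₂ + θ_*(D_yL₀)²/8 − (D_tL₀)²/(8ω(y₀)); dθ̄₂/dt = d/dt[θ_*(D_tL₀)²/(8ω²(y₀))]; dȳ₂/dt = p̄₂ − θ_* D_yL₀ D_tL₀/(4ω(y₀)); dp̄₂/dt = −ω'(y₀)θ̄₂ − θ_*ω''(y₀)ȳ₂ − θ_*² D_yL₀ D_y²L₀/8 + θ_* D_tL₀ D_tD_yL₀/(4ω(y₀)), where L₀ = log ω(y₀), D_t = d/dt, D_y = ∂/∂y. -/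

import Mathlib

open Real Set Filter Topology

/-- `D_t L₀ = ω'(y₀) p₀ / ω(y₀)`. -/
noncomputable def DtL (ω y₀ p₀ : ℝ → ℝ) (t : ℝ) : ℝ :=
  deriv ω (y₀ t) * p₀ t / ω (y₀ t)

/-- `D_y L₀ = ω'(y₀)/ω(y₀)`. -/
noncomputable def DyL (ω y₀ : ℝ → ℝ) (t : ℝ) : ℝ :=
  deriv ω (y₀ t) / ω (y₀ t)

/-- `D_y² L₀ = ω''(y₀)/ω(y₀) − (ω'(y₀)/ω(y₀))²`. -/
noncomputable def Dy2L (ω y₀ : ℝ → ℝ) (t : ℝ) : ℝ :=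
  deriv (deriv ω) (y₀ t) / ω (y₀ t) - (deriv ω (y₀ t) / ω (y₀ t)) ^ 2

/-- `D_t D_y L₀ = d/dt(ω'(y₀)/ω(y₀))`. -/
noncomputable def DtDyL (ω y₀ : ℝ → ℝ) (t : ℝ) : ℝ :=
  deriv (fun s => deriv ω (y₀ s) / ω (y₀ s)) t

/-- The oscillatory part `[θ₁]^ε`. -/
noncomputable def oscθ1 (ω y₀ p₀ φ₀ : ℝ → ℝ) (θs ε t : ℝ) : ℝ :=
  -(θs * DtL ω y₀ p₀ t / (2 * ω (y₀ t))) * Real.sin (2 * φ₀ t / ε)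

/-- The oscillatory part `[φ₂]^ε`. -/
noncomputable def oscφ2 (ω y₀ p₀ φ₀ : ℝ → ℝ) (ε t : ℝ) : ℝ :=
  -(DtL ω y₀ p₀ t / (4 * ω (y₀ t))) * Real.cos (2 * φ₀ t / ε)

/-- The oscillatory part `[y₂]^ε`. -/
noncomputable def oscy2 (ω y₀ φ₀ : ℝ → ℝ) (θs ε t : ℝ) : ℝ :=
  -(θs * DyL ω y₀ t / (4 * ω (y₀ t))) * Real.cos (2 * φ₀ t / ε)

/-- The oscillatory part `[p₂]^ε`. -/
noncomputable def oscp2 (ω y₀ φ₀ : ℝ → ℝ) (θs ε t : ℝ) : ℝ :=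
  deriv (fun s => θs * DyL ω y₀ s / (4 * ω (y₀ s))) t * Real.cos (2 * φ₀ t / ε)

/-- The oscillatory part `[θ₂]^ε` (depends on the averaged `φ̄₂`). -/
noncomputable def oscθ2 (ω y₀ p₀ φ₀ φbar2 : ℝ → ℝ) (θs ε t : ℝ) : ℝ :=
  -(θs * DyL ω y₀ t) * oscy2 ω y₀ φ₀ θs ε t
    - (p₀ t / ω (y₀ t)) * oscp2 ω y₀ φ₀ θs ε t
    + (θs ^ 2 * (DyL ω y₀ t) ^ 2 / (16 * ω (y₀ t))) * Real.cos (4 * φ₀ t / ε)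
    - (θs * DtL ω y₀ p₀ t / ω (y₀ t)) * φbar2 t * Real.cos (2 * φ₀ t / ε)

/-- The filter `ε → 0⁺`, uniformly in `t ∈ [0, T]`. -/
def fastLimit (T : ℝ) : Filter (ℝ × ℝ) := 𝓝[>] (0 : ℝ) ×ˢ 𝓟 (Icc 0 T)

lemma TendstoUniformlyOn.tendsto_fastLimit {T : ℝ} {F : ℝ → ℝ → ℝ} {f : ℝ → ℝ}
    (h : TendstoUniformlyOn F f (𝓝[>] (0 : ℝ)) (Icc 0 T)) :
    Tendsto (fun q : ℝ × ℝ => F q.1 q.2 - f q.2) (fastLimit T) (𝓝 0) := by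
  rw [tendstoUniformlyOn_iff_tendsto, Metric.uniformity_eq_comap_nhds_zero, tendsto_comap_iff] at h
  rw [tendsto_zero_iff_abs_tendsto_zero]
  refine h.congr fun q => ?_
  simp [Real.dist_eq, abs_sub_comm]

/-- Along an ultrafilter the slow time and the fast phase both converge. -/
lemma Ultrafilter.exists_phase_limit {T : ℝ} (φ₀ : ℝ → ℝ) {U : Ultrafilter (ℝ × ℝ)}
    (hU : (U : Filter (ℝ × ℝ)) ≤ fastLimit T) :
    (∀ᶠ q in (U : Filter (ℝ × ℝ)), 0 < q.1 ∧ q.2 ∈ Icc 0 T) ∧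
      Tendsto Prod.fst (U : Filter (ℝ × ℝ)) (𝓝 0) ∧
      ∃ t ∈ Icc 0 T, ∃ S C : ℝ, S ^ 2 + C ^ 2 = 1 ∧
        Tendsto Prod.snd (U : Filter (ℝ × ℝ)) (𝓝 t) ∧
        Tendsto (fun q : ℝ × ℝ => Real.sin (2 * φ₀ q.2 / q.1)) U (𝓝 S) ∧
        Tendsto (fun q : ℝ × ℝ => Real.cos (2 * φ₀ q.2 / q.1)) U (𝓝 C) := by
  have hfst : Tendsto Prod.fst (U : Filter (ℝ × ℝ)) (𝓝[>] 0) := tendsto_fst.mono_left hU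
  have hsnd : Tendsto Prod.snd (U : Filter (ℝ × ℝ)) (𝓟 (Icc 0 T)) := tendsto_snd.mono_left hU
  obtain ⟨t, ht, hUt⟩ := isCompact_Icc.ultrafilter_le_nhds (U.map Prod.snd) hsnd
  have key : ∀ f : ℝ × ℝ → ℝ, (∀ q, f q ∈ Icc (-1 : ℝ) 1) →
      ∃ x, Tendsto f (U : Filter (ℝ × ℝ)) (𝓝 x) := fun f hf => by
    obtain ⟨x, -, hx⟩ := isCompact_Icc.ultrafilter_le_nhds (U.map f)
      (tendsto_principal.2 (Eventually.of_forall hf))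
    exact ⟨x, hx⟩
  obtain ⟨S, hS⟩ := key (fun q => Real.sin (2 * φ₀ q.2 / q.1)) fun q => Real.sin_mem_Icc _
  obtain ⟨C, hC⟩ := key (fun q => Real.cos (2 * φ₀ q.2 / q.1)) fun q => Real.cos_mem_Icc _
  refine ⟨(hfst.eventually self_mem_nhdsWithin).and (tendsto_principal.1 hsnd),
    hfst.mono_right nhdsWithin_le_nhds, t, ht, S, C, ?_, hUt, hS, hC⟩
  refine tendsto_nhds_unique ((hS.pow 2).add (hC.pow 2)) (tendsto_const_nhds.congr fun q => ?_)
  exact (Real.sin_sq_add_cos_sq _).symm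

/-- If the derivatives of a convergent family tend to zero uniformly, the limit is constant. -/
lemma limit_eq_of_deriv_tendsto_zero {T : ℝ} {Z Z' : ℝ → ℝ → ℝ} {z : ℝ → ℝ}
    (hZ : ∀ ε > 0, ∀ s ∈ Icc 0 T, HasDerivAt (Z ε) (Z' ε s) s)
    (hZ' : Tendsto (fun q : ℝ × ℝ => Z' q.1 q.2) (fastLimit T) (𝓝 0))
    (hz : ∀ s ∈ Icc 0 T, Tendsto (fun ε => Z ε s) (𝓝[>] 0) (𝓝 (z s)))
    {t : ℝ} (ht : t ∈ Icc 0 T) : z t = z 0 := by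
  have h0 : (0 : ℝ) ∈ Icc 0 T := ⟨le_rfl, ht.1.trans ht.2⟩
  have hlim : Tendsto (fun ε => Z ε t - Z ε 0) (𝓝[>] 0) (𝓝 0) := by
    rw [Metric.tendsto_nhds]
    intro δ hδ
    have hη : 0 < δ / (t + 1) := div_pos hδ (by linarith [ht.1])
    have h1 := Metric.tendsto_nhds.1 hZ' _ hη
    rw [fastLimit, eventually_prod_principal_iff] at h1
    filter_upwards [h1, self_mem_nhdsWithin] with ε hε hpos
    have h2 := (convex_Icc 0 T).norm_image_sub_le_of_norm_hasDerivWithin_le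
      (fun s hs => (hZ ε hpos s hs).hasDerivWithinAt)
      (fun s hs => by simpa using (hε s hs).le) h0 ht
    rw [Real.dist_eq, sub_zero, ← Real.norm_eq_abs]
    refine h2.trans_lt ?_
    rw [sub_zero, Real.norm_of_nonneg ht.1, div_mul_eq_mul_div, div_lt_iff₀ (by linarith [ht.1])]
    nlinarith
  exact sub_eq_zero.1 (tendsto_nhds_unique ((hz t ht).sub (hz 0 h0)) hlim)

lemma deriv_eq_of_hasDerivAt_of_eqOn_Icc {T : ℝ} (hT : 0 < T) {f g : ℝ → ℝ} {c g' t : ℝ}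
    (hf : DifferentiableAt ℝ f t) (hg : HasDerivAt g g' t)
    (hfg : ∀ s ∈ Icc 0 T, f s = g s + c) (ht : t ∈ Icc 0 T) : deriv f t = g' :=
  (uniqueDiffOn_Icc hT t ht).eq_deriv _ hf.hasDerivAt.hasDerivWithinAt
    ((hg.add_const c).hasDerivWithinAt.congr hfg (hfg t ht))

/-- Averaging: oscillations of the derivative at the phases `2φ₀/ε` and `4φ₀/ε` do not
contribute to the derivative of the limit. -/
lemma deriv_limit_eq_average {T : ℝ} (hT : 0 < T) {φ₀ Ω g α β x : ℝ → ℝ} {X X' : ℝ → ℝ → ℝ}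
    (hφ₀ : ∀ s ∈ Icc 0 T, HasDerivAt φ₀ (Ω s) s)
    (hg : Continuous g) (hα : ContDiff ℝ 1 α) (hβ : ContDiff ℝ 1 β) (hx : Differentiable ℝ x)
    (hX : ∀ ε > 0, ∀ s ∈ Icc 0 T, HasDerivAt (X ε) (X' ε s) s)
    (hX' : Tendsto (fun q : ℝ × ℝ => X' q.1 q.2 - (g q.2
      + Ω q.2 * α q.2 * Real.cos (2 * φ₀ q.2 / q.1)
      + Ω q.2 * β q.2 * (Real.cos (2 * φ₀ q.2 / q.1) ^ 2 - Real.sin (2 * φ₀ q.2 / q.1) ^ 2)))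
      (fastLimit T) (𝓝 0))
    (hXx : Tendsto (fun q : ℝ × ℝ => X q.1 q.2 - x q.2) (fastLimit T) (𝓝 0))
    {t : ℝ} (ht : t ∈ Icc 0 T) : deriv x t = g t := by
  set G : ℝ → ℝ := fun s => ∫ r in (0 : ℝ)..s, g r with hGdef
  have hG : ∀ s, HasDerivAt G (g s) s := fun s => hg.integral_hasStrictDerivAt 0 s |>.hasDerivAt
  have hα' : Continuous (deriv α) := hα.continuous_deriv le_rfl
  have hβ' : Continuous (deriv β) := hβ.continuous_deriv le_rfl
  suffices h : ∀ s ∈ Icc 0 T, x s - G s = x 0 - G 0 from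
    deriv_eq_of_hasDerivAt_of_eqOn_Icc hT (hx t) (hG t) (c := x 0 - G 0)
      (fun s hs => by linarith [h s hs]) ht
  intro s hs
  refine limit_eq_of_deriv_tendsto_zero (T := T) (z := fun s => x s - G s)
    (Z := fun ε s => X ε s - G s - ε / 2 * (α s * Real.sin (2 * φ₀ s / ε))
      - ε / 2 * (β s * (Real.sin (2 * φ₀ s / ε) * Real.cos (2 * φ₀ s / ε))))
    (Z' := fun ε s => (X' ε s - (g s + Ω s * α s * Real.cos (2 * φ₀ s / ε)
      + Ω s * β s * (Real.cos (2 * φ₀ s / ε) ^ 2 - Real.sin (2 * φ₀ s / ε) ^ 2)))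
      - ε / 2 * (deriv α s * Real.sin (2 * φ₀ s / ε)
        + deriv β s * (Real.sin (2 * φ₀ s / ε) * Real.cos (2 * φ₀ s / ε)))) ?_ ?_ ?_ hs
  · intro ε hε r hr
    have hθ : HasDerivAt (fun s => 2 * φ₀ s / ε) (2 * Ω r / ε) r :=
      ((hφ₀ r hr).const_mul 2).div_const ε
    have hαr := (hα.differentiable one_ne_zero r).hasDerivAt
    have hβr := (hβ.differentiable one_ne_zero r).hasDerivAt
    refine ((((hX ε hε r hr).sub (hG r)).sub ((hαr.mul hθ.sin).const_mul (ε / 2))).sub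
      ((hβr.mul (hθ.sin.mul hθ.cos)).const_mul (ε / 2))).congr_deriv ?_
    have hε0 : ε ≠ 0 := hε.ne'
    simp only [Pi.mul_apply]
    field_simp
    ring
  · rw [← sub_zero (0 : ℝ)]
    refine hX'.sub (tendsto_iff_ultrafilter _ _ _ |>.2 fun U hU => ?_)
    obtain ⟨-, hε, r, -, S, C, -, hr, hS, hC⟩ := U.exists_phase_limit φ₀ hU
    simpa using (hε.div_const 2).mul (((hα'.tendsto r).comp hr |>.mul hS).add
      (((hβ'.tendsto r).comp hr).mul (hS.mul hC)))
  · intro r hr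
    have hpure : Tendsto (fun ε : ℝ => (ε, r)) (𝓝[>] 0) (fastLimit T) :=
      tendsto_id.prodMk (tendsto_const_pure.mono_right (by simpa using hr))
    have h1 := (hXx.comp hpure).add_const (x r - G r)
    have h2 : Tendsto (fun q : ℝ × ℝ => q.1 / 2 * (α q.2 * Real.sin (2 * φ₀ q.2 / q.1)
        + β q.2 * (Real.sin (2 * φ₀ q.2 / q.1) * Real.cos (2 * φ₀ q.2 / q.1))))
        (fastLimit T) (𝓝 0) := by
      refine tendsto_iff_ultrafilter _ _ _ |>.2 fun U hU => ?_
      obtain ⟨-, hε, r, -, S, C, -, hr, hS, hC⟩ := U.exists_phase_limit φ₀ hU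
      simpa using (hε.div_const 2).mul (((hα.continuous.tendsto r).comp hr |>.mul hS).add
        (((hβ.continuous.tendsto r).comp hr).mul (hS.mul hC)))
    have h3 := h1.sub (h2.comp hpure)
    simp only [zero_add, sub_zero] at h3
    refine h3.congr fun ε => ?_
    simp only [Function.comp]
    ring

/-- A difference quotient at a converging pair of points, on an arbitrary scale `h`. -/
lemma HasStrictDerivAt.tendsto_sub_div {ι : Type*} {F : Filter ι} {f : ℝ → ℝ} {f' x v : ℝ}
    (hf : HasStrictDerivAt f f' x) {a b h : ι → ℝ} (ha : Tendsto a F (𝓝 x))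
    (hb : Tendsto b F (𝓝 x)) (hv : Tendsto (fun i => (a i - b i) / h i) F (𝓝 v))
    (hh : ∀ᶠ i in F, h i ≠ 0) :
    Tendsto (fun i => (f (a i) - f (b i)) / h i) F (𝓝 (f' * v)) := by
  have h1 := hf.hasStrictFDerivAt.isLittleO.comp_tendsto (ha.prodMk_nhds hb)
  have h2 : (fun i => a i - b i) =O[F] h := by
    refine (hv.isBigO_one ℝ).mul (Asymptotics.isBigO_refl h F) |>.congr' ?_ ?_
    · filter_upwards [hh] with i hi
      exact div_mul_cancel₀ _ hi
    · simp
  have h3 := (h1.trans_isBigO h2).tendsto_div_nhds_zero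
  have h4 := h3.add (hv.const_mul f')
  rw [zero_add] at h4
  refine h4.congr fun i => ?_
  simp only [Function.comp, ContinuousLinearMap.toSpanSingleton_apply, smul_eq_mul]
  ring

lemma tendsto_of_congr_of_eq {ι : Type*} {F : Filter ι} {f g : ι → ℝ} {a b : ℝ}
    (hf : Tendsto f F (𝓝 a)) (hfg : ∀ᶠ i in F, f i = g i) (hab : a = b) :
    Tendsto g F (𝓝 b) :=
  hab ▸ hf.congr' hfg

/-- The slow-fast system in terms of the frequency `w` and the derivatives `l = (log w)'` and
`m = (log w)''`, together with its limit and the second-order residual expansion. -/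
structure SlowFastExpansion (T θs : ℝ) (w l m : ℝ → ℝ) (φ θ y p : ℝ → ℝ → ℝ)
    (φ₀ y₀ p₀ φb θb yb pb : ℝ → ℝ) : Prop where
  T_pos : 0 < T
  w_pos : ∀ x, 0 < w x
  hasDerivAt_w : ∀ x, HasDerivAt w (l x * w x) x
  hasDerivAt_l : ∀ x, HasDerivAt l (m x) x
  contDiff_w : ContDiff ℝ 2 w
  contDiff_l : ContDiff ℝ 2 l
  contDiff_m : ContDiff ℝ 2 m
  differentiable : ∀ ε > 0, Differentiable ℝ (φ ε) ∧ Differentiable ℝ (θ ε) ∧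
    Differentiable ℝ (y ε) ∧ Differentiable ℝ (p ε)
  deriv_φ : ∀ ε > 0, ∀ s ∈ Icc 0 T, deriv (φ ε) s = w (y ε s)
    + ε * (p ε s * l (y ε s) / 2) * Real.sin (2 * φ ε s / ε)
    + ε ^ 2 * (θ ε s * l (y ε s) ^ 2 / 4) * Real.sin (2 * φ ε s / ε) ^ 2
  deriv_θ : ∀ ε > 0, ∀ s ∈ Icc 0 T, deriv (θ ε) s =
    -(θ ε s * p ε s * l (y ε s)) * Real.cos (2 * φ ε s / ε)
    - ε * (θ ε s ^ 2 * l (y ε s) ^ 2 / 2)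
      * (Real.sin (2 * φ ε s / ε) * Real.cos (2 * φ ε s / ε))
  deriv_y : ∀ ε > 0, ∀ s ∈ Icc 0 T, deriv (y ε) s = p ε s
    + ε * (θ ε s * l (y ε s) / 2) * Real.sin (2 * φ ε s / ε)
  deriv_p : ∀ ε > 0, ∀ s ∈ Icc 0 T, deriv (p ε) s = -(θ ε s * (l (y ε s) * w (y ε s)))
    - ε * (θ ε s * p ε s * m (y ε s) / 2) * Real.sin (2 * φ ε s / ε)
    - ε ^ 2 * (θ ε s ^ 2 * l (y ε s) * m (y ε s) / 4) * Real.sin (2 * φ ε s / ε) ^ 2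
  initial : ∀ ε > 0, φ ε 0 = 0 ∧ θ ε 0 = θs ∧ y ε 0 = y₀ 0 ∧ p ε 0 = p₀ 0
  contDiff_φ₀ : ContDiff ℝ 1 φ₀
  contDiff_y₀ : ContDiff ℝ 1 y₀
  contDiff_p₀ : ContDiff ℝ 1 p₀
  deriv_φ₀ : ∀ s ∈ Icc 0 T, HasDerivAt φ₀ (w (y₀ s)) s
  deriv_y₀ : ∀ s ∈ Icc 0 T, HasDerivAt y₀ (p₀ s) s
  deriv_p₀ : ∀ s ∈ Icc 0 T, HasDerivAt p₀ (-(θs * (l (y₀ s) * w (y₀ s)))) s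
  contDiff_φb : ContDiff ℝ 1 φb
  contDiff_θb : ContDiff ℝ 1 θb
  contDiff_yb : ContDiff ℝ 1 yb
  contDiff_pb : ContDiff ℝ 1 pb
  residual_φ : Tendsto (fun q : ℝ × ℝ => (φ q.1 q.2 - φ₀ q.2) / q.1 ^ 2
    + p₀ q.2 * l (y₀ q.2) / (4 * w (y₀ q.2)) * Real.cos (2 * φ₀ q.2 / q.1) - φb q.2)
    (fastLimit T) (𝓝 0)
  residual_y : Tendsto (fun q : ℝ × ℝ => (y q.1 q.2 - y₀ q.2) / q.1 ^ 2
    + θs * l (y₀ q.2) / (4 * w (y₀ q.2)) * Real.cos (2 * φ₀ q.2 / q.1) - yb q.2)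
    (fastLimit T) (𝓝 0)
  residual_p : Tendsto (fun q : ℝ × ℝ => (p q.1 q.2 - p₀ q.2) / q.1 ^ 2
    - θs * p₀ q.2 * (m (y₀ q.2) - l (y₀ q.2) ^ 2) / (4 * w (y₀ q.2))
      * Real.cos (2 * φ₀ q.2 / q.1) - pb q.2)
    (fastLimit T) (𝓝 0)
  residual_θ : Tendsto (fun q : ℝ × ℝ => ((θ q.1 q.2 - θs) / q.1
      + θs * p₀ q.2 * l (y₀ q.2) / (2 * w (y₀ q.2)) * Real.sin (2 * φ₀ q.2 / q.1)) / q.1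
    - ((θs ^ 2 * l (y₀ q.2) ^ 2 / (4 * w (y₀ q.2))
          - θs * p₀ q.2 ^ 2 * (m (y₀ q.2) - l (y₀ q.2) ^ 2) / (4 * w (y₀ q.2) ^ 2)
          - θs * p₀ q.2 * l (y₀ q.2) / w (y₀ q.2) * φb q.2) * Real.cos (2 * φ₀ q.2 / q.1)
        + θs ^ 2 * l (y₀ q.2) ^ 2 / (16 * w (y₀ q.2))
          * (Real.cos (2 * φ₀ q.2 / q.1) ^ 2 - Real.sin (2 * φ₀ q.2 / q.1) ^ 2))
    - θb q.2) (fastLimit T) (𝓝 0)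

namespace SlowFastExpansion

variable {T θs : ℝ} {w l m : ℝ → ℝ} {φ θ y p : ℝ → ℝ → ℝ}
  {φ₀ y₀ p₀ φb θb yb pb : ℝ → ℝ}

/-- The limits of the solution and its residuals along an ultrafilter, as functions of the limits
`S`, `C` of the sine and cosine of the fast phase. -/
structure Limits (θs : ℝ) (w l m : ℝ → ℝ) (φ θ y p : ℝ → ℝ → ℝ)
    (φ₀ y₀ p₀ φb θb yb pb : ℝ → ℝ) (U : Filter (ℝ × ℝ)) (t S C Φ Y P Θ : ℝ) : Prop where
  sq_add_sq : S ^ 2 + C ^ 2 = 1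
  scale_pos : ∀ᶠ q in U, 0 < q.1
  scale : Tendsto Prod.fst U (𝓝 0)
  time : Tendsto Prod.snd U (𝓝 t)
  sin₀ : Tendsto (fun q : ℝ × ℝ => Real.sin (2 * φ₀ q.2 / q.1)) U (𝓝 S)
  cos₀ : Tendsto (fun q : ℝ × ℝ => Real.cos (2 * φ₀ q.2 / q.1)) U (𝓝 C)
  sin : Tendsto (fun q : ℝ × ℝ => Real.sin (2 * φ q.1 q.2 / q.1)) U (𝓝 S)
  cos : Tendsto (fun q : ℝ × ℝ => Real.cos (2 * φ q.1 q.2 / q.1)) U (𝓝 C)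
  sin_sub : Tendsto (fun q : ℝ × ℝ => (Real.sin (2 * φ q.1 q.2 / q.1)
    - Real.sin (2 * φ₀ q.2 / q.1)) / q.1) U (𝓝 (2 * Φ * C))
  lim_y : Tendsto (fun q : ℝ × ℝ => y q.1 q.2) U (𝓝 (y₀ t))
  lim_p : Tendsto (fun q : ℝ × ℝ => p q.1 q.2) U (𝓝 (p₀ t))
  lim_θ : Tendsto (fun q : ℝ × ℝ => θ q.1 q.2) U (𝓝 θs)
  res_φ : Tendsto (fun q : ℝ × ℝ => (φ q.1 q.2 - φ₀ q.2) / q.1 ^ 2) U (𝓝 Φ)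
  res_y : Tendsto (fun q : ℝ × ℝ => (y q.1 q.2 - y₀ q.2) / q.1 ^ 2) U (𝓝 Y)
  res_p : Tendsto (fun q : ℝ × ℝ => (p q.1 q.2 - p₀ q.2) / q.1 ^ 2) U (𝓝 P)
  res_θ : Tendsto (fun q : ℝ × ℝ => ((θ q.1 q.2 - θs) / q.1
      + θs * p₀ q.2 * l (y₀ q.2) / (2 * w (y₀ q.2)) * Real.sin (2 * φ₀ q.2 / q.1)) / q.1)
    U (𝓝 Θ)
  eq_Φ : Φ = φb t - p₀ t * l (y₀ t) / (4 * w (y₀ t)) * C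
  eq_Y : Y = yb t - θs * l (y₀ t) / (4 * w (y₀ t)) * C
  eq_P : P = pb t + θs * p₀ t * (m (y₀ t) - l (y₀ t) ^ 2) / (4 * w (y₀ t)) * C
  eq_Θ : Θ = θb t + (θs ^ 2 * l (y₀ t) ^ 2 / (4 * w (y₀ t))
      - θs * p₀ t ^ 2 * (m (y₀ t) - l (y₀ t) ^ 2) / (4 * w (y₀ t) ^ 2)
      - θs * p₀ t * l (y₀ t) / w (y₀ t) * φb t) * C
    + θs ^ 2 * l (y₀ t) ^ 2 / (16 * w (y₀ t)) * (C ^ 2 - S ^ 2)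

theorem exists_limits (h : SlowFastExpansion T θs w l m φ θ y p φ₀ y₀ p₀ φb θb yb pb)
    {U : Ultrafilter (ℝ × ℝ)} (hU : (U : Filter (ℝ × ℝ)) ≤ fastLimit T) :
    (∀ᶠ q in (U : Filter (ℝ × ℝ)), 0 < q.1 ∧ q.2 ∈ Icc 0 T) ∧ ∃ t ∈ Icc 0 T,
      ∃ S C Φ Y P Θ : ℝ, Limits θs w l m φ θ y p φ₀ y₀ p₀ φb θb yb pb U t S C Φ Y P Θ := by
  obtain ⟨hev, hε, t, ht, S, C, hSC, hs, hS, hC⟩ := U.exists_phase_limit φ₀ hU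
  have hpos : ∀ᶠ q in (U : Filter (ℝ × ℝ)), 0 < q.1 := hev.mono fun q hq => hq.1
  have hw0 : w (y₀ t) ≠ 0 := (h.w_pos _).ne'
  have ly := (h.contDiff_y₀.continuous.tendsto t).comp hs
  have lp := (h.contDiff_p₀.continuous.tendsto t).comp hs
  have lw := (h.contDiff_w.continuous.tendsto _).comp ly
  have ll := (h.contDiff_l.continuous.tendsto _).comp ly
  have lm := (h.contDiff_m.continuous.tendsto _).comp ly
  have lφb := (h.contDiff_φb.continuous.tendsto t).comp hs
  have lθb := (h.contDiff_θb.continuous.tendsto t).comp hs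
  have lyb := (h.contDiff_yb.continuous.tendsto t).comp hs
  have lpb := (h.contDiff_pb.continuous.tendsto t).comp hs
  have res_φ := (h.residual_φ.mono_left hU).add (lφb.sub
    (((lp.mul ll).div (lw.const_mul 4) (by positivity)).mul hC))
  have res_y := (h.residual_y.mono_left hU).add (lyb.sub
    (((ll.const_mul θs).div (lw.const_mul 4) (by positivity)).mul hC))
  have res_p := (h.residual_p.mono_left hU).add (lpb.add
    ((((lp.const_mul θs).mul (lm.sub (ll.pow 2))).div (lw.const_mul 4) (by positivity)).mul hC))
  have res_θ := (h.residual_θ.mono_left hU).add ((lθb.add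
    ((((((ll.pow 2).const_mul (θs ^ 2)).div (lw.const_mul 4) (by positivity)).sub
      ((((lp.pow 2).const_mul θs).mul (lm.sub (ll.pow 2))).div ((lw.pow 2).const_mul 4)
        (by positivity))).sub
      ((((lp.const_mul θs).mul ll).div lw hw0).mul lφb)).mul hC)).add
    ((((ll.pow 2).const_mul (θs ^ 2)).div (lw.const_mul 16) (by positivity)).mul
      ((hC.pow 2).sub (hS.pow 2))))
  rw [zero_add] at res_φ res_y res_p res_θ
  replace res_φ := res_φ.congr (f₂ := fun q : ℝ × ℝ => (φ q.1 q.2 - φ₀ q.2) / q.1 ^ 2)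
    fun q => by simp only [Function.comp, Pi.div_apply]; ring
  replace res_y := res_y.congr (f₂ := fun q : ℝ × ℝ => (y q.1 q.2 - y₀ q.2) / q.1 ^ 2)
    fun q => by simp only [Function.comp, Pi.div_apply]; ring
  replace res_p := res_p.congr (f₂ := fun q : ℝ × ℝ => (p q.1 q.2 - p₀ q.2) / q.1 ^ 2)
    fun q => by simp only [Function.comp, Pi.div_apply]; ring
  replace res_θ := res_θ.congr (f₂ := fun q : ℝ × ℝ => ((θ q.1 q.2 - θs) / q.1
      + θs * p₀ q.2 * l (y₀ q.2) / (2 * w (y₀ q.2)) * Real.sin (2 * φ₀ q.2 / q.1)) / q.1)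
    fun q => by simp only [Function.comp, Pi.div_apply]; ring
  have lim_y : Tendsto (fun q : ℝ × ℝ => y q.1 q.2) U (𝓝 (y₀ t)) := by
    have h1 := ly.add ((hε.pow 2).mul res_y)
    simp only [ne_eq, OfNat.ofNat_ne_zero, not_false_eq_true, zero_pow, zero_mul, add_zero] at h1
    refine h1.congr' (hpos.mono fun q hq => ?_)
    simp only [Function.comp]
    field_simp
    ring
  have lim_p : Tendsto (fun q : ℝ × ℝ => p q.1 q.2) U (𝓝 (p₀ t)) := by
    have h1 := lp.add ((hε.pow 2).mul res_p)
    simp only [ne_eq, OfNat.ofNat_ne_zero, not_false_eq_true, zero_pow, zero_mul, add_zero] at h1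
    refine h1.congr' (hpos.mono fun q hq => ?_)
    simp only [Function.comp]
    field_simp
    ring
  have lim_θ : Tendsto (fun q : ℝ × ℝ => θ q.1 q.2) U (𝓝 θs) := by
    have h1 := (((hε.pow 2).mul res_θ).sub (hε.mul
      ((((lp.const_mul θs).mul ll).div (lw.const_mul 2) (by positivity)).mul hS))).const_add θs
    simp only [ne_eq, OfNat.ofNat_ne_zero, not_false_eq_true, zero_pow, zero_mul, add_zero,
      sub_zero] at h1
    refine h1.congr' (hpos.mono fun q hq => ?_)
    simp only [Function.comp, Pi.div_apply]
    field_simp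
    ring
  set Φ := φb t - p₀ t * l (y₀ t) / (4 * w (y₀ t)) * C with hΦ
  have hshift : Tendsto (fun q : ℝ × ℝ => (2 * (φ q.1 q.2 - φ₀ q.2) / q.1 - 0) / q.1) U
      (𝓝 (2 * Φ)) :=
    (res_φ.const_mul 2).congr fun q => by ring
  have hshift0 : Tendsto (fun q : ℝ × ℝ => 2 * (φ q.1 q.2 - φ₀ q.2) / q.1) U (𝓝 0) := by
    have h1 := hε.mul hshift
    rw [zero_mul] at h1
    refine h1.congr' (hpos.mono fun q hq => ?_)
    field_simp
    ring
  have hne : ∀ᶠ q in (U : Filter (ℝ × ℝ)), q.1 ≠ 0 := hpos.mono fun q hq => hq.ne'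
  have hphase : ∀ q : ℝ × ℝ, 2 * φ q.1 q.2 / q.1
      = 2 * φ₀ q.2 / q.1 + 2 * (φ q.1 q.2 - φ₀ q.2) / q.1 := fun q => by ring
  have dsin := (Real.hasStrictDerivAt_sin 0).tendsto_sub_div hshift0 tendsto_const_nhds hshift hne
  have dcos := (Real.hasStrictDerivAt_cos 0).tendsto_sub_div hshift0 tendsto_const_nhds hshift hne
  have lsin := (Real.continuous_sin.tendsto 0).comp hshift0
  have lcos := (Real.continuous_cos.tendsto 0).comp hshift0
  simp only [Real.cos_zero, Real.sin_zero, neg_zero, zero_mul, one_mul, sub_zero]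
    at dsin dcos lsin lcos
  refine ⟨hev, t, ht, S, C, Φ, _, _, _, ⟨hSC, hpos, hε, hs, hS, hC, ?_, ?_, ?_, lim_y, lim_p, lim_θ,
    res_φ, res_y, res_p, res_θ, rfl, rfl, rfl, rfl⟩⟩
  · have h1 := (hS.mul lcos).add (hC.mul lsin)
    simp only [mul_one, mul_zero, add_zero] at h1
    exact h1.congr fun q => by rw [hphase, Real.sin_add]; rfl
  · have h1 := (hC.mul lcos).sub (hS.mul lsin)
    simp only [mul_one, mul_zero, sub_zero] at h1
    exact h1.congr fun q => by rw [hphase, Real.cos_add]; rfl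
  · have h1 := (hS.mul dcos).add (hC.mul dsin)
    rw [mul_zero, zero_add, mul_comm] at h1
    exact h1.congr fun q => by rw [hphase, Real.sin_add]; ring

theorem hasDerivAt_div_w (h : SlowFastExpansion T θs w l m φ θ y p φ₀ y₀ p₀ φb θb yb pb)
    {f : ℝ → ℝ} {f' x : ℝ} (hf : HasDerivAt f f' x) :
    HasDerivAt (fun x => f x / w x) ((f' - f x * l x) / w x) x := by
  have hw := (h.w_pos x).ne'
  refine (hf.div (h.hasDerivAt_w x) hw).congr_deriv ?_
  field_simp

theorem hasDerivAt_phase (h : SlowFastExpansion T θs w l m φ θ y p φ₀ y₀ p₀ φb θb yb pb)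
    {ε : ℝ} (hε : 0 < ε) (s : ℝ) :
    HasDerivAt (fun s => 2 * φ ε s / ε) (2 * deriv (φ ε) s / ε) s :=
  (((h.differentiable ε hε).1 s).hasDerivAt.const_mul 2).div_const ε

theorem tendsto_deriv (h : SlowFastExpansion T θs w l m φ θ y p φ₀ y₀ p₀ φb θb yb pb)
    {U : Filter (ℝ × ℝ)} {t S C Φ Y P Θ : ℝ} (hU : ∀ᶠ q in U, 0 < q.1 ∧ q.2 ∈ Icc 0 T)
    (L : Limits θs w l m φ θ y p φ₀ y₀ p₀ φb θb yb pb U t S C Φ Y P Θ) :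
    Tendsto (fun q : ℝ × ℝ => deriv (θ q.1) q.2) U (𝓝 (-(θs * p₀ t * l (y₀ t)) * C)) ∧
    Tendsto (fun q : ℝ × ℝ => deriv (y q.1) q.2) U (𝓝 (p₀ t)) ∧
    Tendsto (fun q : ℝ × ℝ => deriv (p q.1) q.2) U (𝓝 (-(θs * (l (y₀ t) * w (y₀ t))))) := by
  have lw := (h.contDiff_w.continuous.tendsto _).comp L.lim_y
  have ll := (h.contDiff_l.continuous.tendsto _).comp L.lim_y
  have lm := (h.contDiff_m.continuous.tendsto _).comp L.lim_y
  refine ⟨?_, ?_, ?_⟩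
  · have h1 := ((L.lim_θ.mul L.lim_p).mul ll).neg.mul L.cos |>.sub
      ((L.scale.mul (((L.lim_θ.pow 2).mul (ll.pow 2)).div_const 2)).mul (L.sin.mul L.cos))
    rw [zero_mul, zero_mul, sub_zero] at h1
    exact h1.congr' (hU.mono fun q hq => (h.deriv_θ q.1 hq.1 q.2 hq.2).symm)
  · have h1 := L.lim_p.add ((L.scale.mul ((L.lim_θ.mul ll).div_const 2)).mul L.sin)
    rw [zero_mul, zero_mul, add_zero] at h1
    exact h1.congr' (hU.mono fun q hq => (h.deriv_y q.1 hq.1 q.2 hq.2).symm)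
  · have h1 := ((L.lim_θ.mul (ll.mul lw)).neg.sub
      ((L.scale.mul (((L.lim_θ.mul L.lim_p).mul lm).div_const 2)).mul L.sin)).sub
      (((L.scale.pow 2).mul ((((L.lim_θ.pow 2).mul ll).mul lm).div_const 4)).mul (L.sin.pow 2))
    simp only [ne_eq, OfNat.ofNat_ne_zero, not_false_eq_true, zero_pow, zero_mul, sub_zero] at h1
    exact h1.congr' (hU.mono fun q hq => (h.deriv_p q.1 hq.1 q.2 hq.2).symm)

/-- Second-order difference quotient of a smooth function of `y`. -/
theorem Limits.tendsto_comp_y {U : Filter (ℝ × ℝ)} {t S C Φ Y P Θ : ℝ}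
    (L : Limits θs w l m φ θ y p φ₀ y₀ p₀ φb θb yb pb U t S C Φ Y P Θ)
    (hy₀ : Continuous y₀) {f : ℝ → ℝ} {f' : ℝ} (hf : HasStrictDerivAt f f' (y₀ t)) :
    Tendsto (fun q : ℝ × ℝ => (f (y q.1 q.2) - f (y₀ q.2)) / q.1 ^ 2) U (𝓝 (f' * Y)) :=
  hf.tendsto_sub_div L.lim_y ((hy₀.tendsto t).comp L.time) L.res_y
    (L.scale_pos.mono fun q hq => by positivity)

theorem hasStrictDerivAt_w (h : SlowFastExpansion T θs w l m φ θ y p φ₀ y₀ p₀ φb θb yb pb)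
    (x : ℝ) : HasStrictDerivAt w (l x * w x) x :=
  h.contDiff_w.contDiffAt.hasStrictDerivAt' (h.hasDerivAt_w x) (by norm_num)

theorem hasStrictDerivAt_l (h : SlowFastExpansion T θs w l m φ θ y p φ₀ y₀ p₀ φb θb yb pb)
    (x : ℝ) : HasStrictDerivAt l (m x) x :=
  h.contDiff_l.contDiffAt.hasStrictDerivAt' (h.hasDerivAt_l x) (by norm_num)

theorem contDiff_one (h : SlowFastExpansion T θs w l m φ θ y p φ₀ y₀ p₀ φb θb yb pb) :
    ContDiff ℝ 1 w ∧ ContDiff ℝ 1 l ∧ ContDiff ℝ 1 m ∧ ContDiff ℝ 1 (deriv m) :=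
  ⟨h.contDiff_w.of_le one_le_two, h.contDiff_l.of_le one_le_two, h.contDiff_m.of_le one_le_two,
    ((contDiff_succ_iff_deriv (n := 1)).1 h.contDiff_m).2.2⟩

theorem deriv_φb (h : SlowFastExpansion T θs w l m φ θ y p φ₀ y₀ p₀ φb θb yb pb)
    {t : ℝ} (ht : t ∈ Icc 0 T) :
    deriv φb t = l (y₀ t) * w (y₀ t) * yb t + θs * l (y₀ t) ^ 2 / 8
      - (p₀ t * l (y₀ t)) ^ 2 / (8 * w (y₀ t)) := by
  have hw0 : ∀ s, w (y₀ s) ≠ 0 := fun s => (h.w_pos _).ne'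
  obtain ⟨cw, cl, cm, -⟩ := h.contDiff_one
  have cy := h.contDiff_y₀
  have cp := h.contDiff_p₀
  have cyb := h.contDiff_yb
  set g : ℝ → ℝ := fun s => l (y₀ s) * w (y₀ s) * yb s + θs * l (y₀ s) ^ 2 / 8
      - (p₀ s * l (y₀ s)) ^ 2 / (8 * w (y₀ s)) with hg_def
  set α : ℝ → ℝ := fun s => (p₀ s ^ 2 * (m (y₀ s) - l (y₀ s) ^ 2) / w (y₀ s)
    - 2 * θs * l (y₀ s) ^ 2) / (4 * w (y₀ s)) with hα_def
  set β : ℝ → ℝ := fun s => (p₀ s ^ 2 * l (y₀ s) ^ 2 / w (y₀ s)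
    - θs * l (y₀ s) ^ 2) / (8 * w (y₀ s)) with hβ_def
  have hg : ContDiff ℝ 1 g := by
    simp only [hg_def, div_eq_mul_inv, mul_inv]
    fun_prop (disch := exact hw0)
  have hα : ContDiff ℝ 1 α := by
    simp only [hα_def, div_eq_mul_inv, mul_inv]
    fun_prop (disch := exact hw0)
  have hβ : ContDiff ℝ 1 β := by
    simp only [hβ_def, div_eq_mul_inv, mul_inv]
    fun_prop (disch := exact hw0)
  refine deriv_limit_eq_average h.T_pos h.deriv_φ₀ hg.continuous hα hβ
    (h.contDiff_φb.differentiable one_ne_zero)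
    (X := fun ε s => (φ ε s - φ₀ s) / ε ^ 2
      + p ε s * (l (y ε s) / w (y ε s)) * Real.cos (2 * φ ε s / ε) / 4)
    (X' := fun ε s => (deriv (φ ε) s - w (y₀ s)) / ε ^ 2
      + ((deriv (p ε) s * (l (y ε s) / w (y ε s))
          + p ε s * ((m (y ε s) - l (y ε s) * l (y ε s)) / w (y ε s) * deriv (y ε) s))
          * Real.cos (2 * φ ε s / ε)
        + p ε s * (l (y ε s) / w (y ε s))
          * (-Real.sin (2 * φ ε s / ε) * (2 * deriv (φ ε) s / ε))) / 4) ?_ ?_ ?_ ht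
  · intro ε hε s hs
    obtain ⟨dφ, -, dy, dp⟩ := h.differentiable ε hε
    exact (((dφ s).hasDerivAt.sub (h.deriv_φ₀ s hs)).div_const _).add
      ((((dp s).hasDerivAt.mul ((h.hasDerivAt_div_w (h.hasDerivAt_l (y ε s))).comp s
        (dy s).hasDerivAt)).mul (h.hasDerivAt_phase hε s).cos).div_const 4)
  · refine tendsto_iff_ultrafilter _ _ _ |>.2 fun U hU => ?_
    obtain ⟨hev, t, ht, S, C, Φ, Y, P, Θ, L⟩ := h.exists_limits hU
    obtain ⟨-, Ly', Lp'⟩ := h.tendsto_deriv hev L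
    have lw := (h.contDiff_w.continuous.tendsto _).comp L.lim_y
    have ll := (h.contDiff_l.continuous.tendsto _).comp L.lim_y
    have lm := (h.contDiff_m.continuous.tendsto _).comp L.lim_y
    have lw₀ := ((cw.comp cy).continuous.tendsto t).comp L.time
    have lg := (hg.continuous.tendsto t).comp L.time
    have lα := (hα.continuous.tendsto t).comp L.time
    have lβ := (hβ.continuous.tendsto t).comp L.time
    have h1 := ((((L.tendsto_comp_y h.contDiff_y₀.continuous (h.hasStrictDerivAt_w _)).add
      (((L.lim_θ.mul (ll.pow 2)).div_const 4).mul (L.sin.pow 2))).add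
      (((((Lp'.mul (ll.div lw (hw0 t))).add
        (L.lim_p.mul (((lm.sub (ll.mul ll)).div lw (hw0 t)).mul Ly'))).mul L.cos).div_const 4))).sub
      (((L.lim_p.mul (ll.div lw (hw0 t))).mul (((L.lim_p.mul ll).div_const 4).mul
        (L.sin.pow 2))).add
      (L.scale.mul ((L.lim_p.mul (ll.div lw (hw0 t))).mul
        (((L.lim_θ.mul (ll.pow 2)).div_const 8).mul (L.sin.pow 3)))))).sub
      ((lg.add ((lw₀.mul lα).mul L.cos₀)).add
        ((lw₀.mul lβ).mul ((L.cos₀.pow 2).sub (L.sin₀.pow 2))))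
    refine tendsto_of_congr_of_eq h1 ?_ ?_
    · filter_upwards [hev] with q hq
      have hε := hq.1.ne'
      have hw := (h.w_pos (y q.1 q.2)).ne'
      simp only [Function.comp, Pi.div_apply]
      rw [h.deriv_φ q.1 hq.1 q.2 hq.2]
      field_simp
      ring
    · have hw := hw0 t
      simp only [hg_def, hα_def, hβ_def, L.eq_Y, Function.comp]
      linear_combination (norm := (field_simp; ring))
        (θs * l (y₀ t) ^ 2 / 8 - p₀ t ^ 2 * l (y₀ t) ^ 2 / (8 * w (y₀ t))) * L.sq_add_sq
  · refine tendsto_iff_ultrafilter _ _ _ |>.2 fun U hU => ?_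
    obtain ⟨hev, t, ht, S, C, Φ, Y, P, Θ, L⟩ := h.exists_limits hU
    have lw := (h.contDiff_w.continuous.tendsto _).comp L.lim_y
    have ll := (h.contDiff_l.continuous.tendsto _).comp L.lim_y
    have h1 := (L.res_φ.add (((L.lim_p.mul (ll.div lw (hw0 t))).mul L.cos).div_const 4)).sub
      ((h.contDiff_φb.continuous.tendsto t).comp L.time)
    refine tendsto_of_congr_of_eq h1 (Eventually.of_forall fun q => rfl) ?_
    rw [L.eq_Φ]
    field_simp
    ring

theorem deriv_yb (h : SlowFastExpansion T θs w l m φ θ y p φ₀ y₀ p₀ φb θb yb pb)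
    {t : ℝ} (ht : t ∈ Icc 0 T) :
    deriv yb t = pb t - θs * p₀ t * l (y₀ t) ^ 2 / (4 * w (y₀ t)) := by
  have hw0 : ∀ s, w (y₀ s) ≠ 0 := fun s => (h.w_pos _).ne'
  obtain ⟨cw, cl, cm, -⟩ := h.contDiff_one
  have cy := h.contDiff_y₀
  have cp := h.contDiff_p₀
  have cpb := h.contDiff_pb
  set g : ℝ → ℝ := fun s => pb s - θs * p₀ s * l (y₀ s) ^ 2 / (4 * w (y₀ s)) with hg_def
  set α : ℝ → ℝ := fun s => θs * p₀ s * (m (y₀ s) - l (y₀ s) ^ 2) / (2 * w (y₀ s) ^ 2)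
    with hα_def
  have hg : ContDiff ℝ 1 g := by
    simp only [hg_def, div_eq_mul_inv, mul_inv]
    fun_prop (disch := exact hw0)
  have hα : ContDiff ℝ 1 α := by
    simp only [hα_def, div_eq_mul_inv, mul_inv, ← inv_pow]
    fun_prop (disch := exact hw0)
  refine deriv_limit_eq_average h.T_pos h.deriv_φ₀ hg.continuous hα
    (contDiff_const (c := (0 : ℝ)))
    (h.contDiff_yb.differentiable one_ne_zero)
    (X := fun ε s => (y ε s - y₀ s) / ε ^ 2
      + θ ε s * (l (y ε s) / w (y ε s)) * Real.cos (2 * φ ε s / ε) / 4)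
    (X' := fun ε s => (deriv (y ε) s - p₀ s) / ε ^ 2
      + ((deriv (θ ε) s * (l (y ε s) / w (y ε s))
          + θ ε s * ((m (y ε s) - l (y ε s) * l (y ε s)) / w (y ε s) * deriv (y ε) s))
          * Real.cos (2 * φ ε s / ε)
        + θ ε s * (l (y ε s) / w (y ε s))
          * (-Real.sin (2 * φ ε s / ε) * (2 * deriv (φ ε) s / ε))) / 4) ?_ ?_ ?_ ht
  · intro ε hε s hs
    obtain ⟨-, dθ, dy, -⟩ := h.differentiable ε hε
    exact (((dy s).hasDerivAt.sub (h.deriv_y₀ s hs)).div_const _).add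
      ((((dθ s).hasDerivAt.mul ((h.hasDerivAt_div_w (h.hasDerivAt_l (y ε s))).comp s
        (dy s).hasDerivAt)).mul (h.hasDerivAt_phase hε s).cos).div_const 4)
  · refine tendsto_iff_ultrafilter _ _ _ |>.2 fun U hU => ?_
    obtain ⟨hev, t, ht, S, C, Φ, Y, P, Θ, L⟩ := h.exists_limits hU
    obtain ⟨Lθ', Ly', -⟩ := h.tendsto_deriv hev L
    have lw := (h.contDiff_w.continuous.tendsto _).comp L.lim_y
    have ll := (h.contDiff_l.continuous.tendsto _).comp L.lim_y
    have lm := (h.contDiff_m.continuous.tendsto _).comp L.lim_y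
    have lw₀ := ((cw.comp cy).continuous.tendsto t).comp L.time
    have lg := (hg.continuous.tendsto t).comp L.time
    have lα := (hα.continuous.tendsto t).comp L.time
    have h1 := ((L.res_p.add
      (((((Lθ'.mul (ll.div lw (hw0 t))).add
        (L.lim_θ.mul (((lm.sub (ll.mul ll)).div lw (hw0 t)).mul Ly'))).mul L.cos).div_const 4))).sub
      (((L.lim_θ.mul (ll.div lw (hw0 t))).mul (((L.lim_p.mul ll).div_const 4).mul
        (L.sin.pow 2))).add
      (L.scale.mul ((L.lim_θ.mul (ll.div lw (hw0 t))).mul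
        (((L.lim_θ.mul (ll.pow 2)).div_const 8).mul (L.sin.pow 3)))))).sub
      (lg.add ((lw₀.mul lα).mul L.cos₀))
    refine tendsto_of_congr_of_eq h1 ?_ ?_
    · filter_upwards [hev] with q hq
      have hε := hq.1.ne'
      have hw := (h.w_pos (y q.1 q.2)).ne'
      simp only [Function.comp, Pi.div_apply]
      nth_rw 2 [h.deriv_y q.1 hq.1 q.2 hq.2]
      rw [h.deriv_φ q.1 hq.1 q.2 hq.2]
      field_simp
      ring
    · have hw := hw0 t
      simp only [hg_def, hα_def, L.eq_P, Function.comp]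
      linear_combination (norm := (field_simp; ring))
        (-(θs * p₀ t * l (y₀ t) ^ 2 / (4 * w (y₀ t)))) * L.sq_add_sq
  · refine tendsto_iff_ultrafilter _ _ _ |>.2 fun U hU => ?_
    obtain ⟨hev, t, ht, S, C, Φ, Y, P, Θ, L⟩ := h.exists_limits hU
    have lw := (h.contDiff_w.continuous.tendsto _).comp L.lim_y
    have ll := (h.contDiff_l.continuous.tendsto _).comp L.lim_y
    have h1 := (L.res_y.add (((L.lim_θ.mul (ll.div lw (hw0 t))).mul L.cos).div_const 4)).sub
      ((h.contDiff_yb.continuous.tendsto t).comp L.time)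
    refine tendsto_of_congr_of_eq h1 (Eventually.of_forall fun q => rfl) ?_
    rw [L.eq_Y]
    field_simp
    ring

theorem deriv_pb (h : SlowFastExpansion T θs w l m φ θ y p φ₀ y₀ p₀ φb θb yb pb)
    {t : ℝ} (ht : t ∈ Icc 0 T) :
    deriv pb t = -(l (y₀ t) * w (y₀ t) * θb t)
      - θs * ((m (y₀ t) + l (y₀ t) ^ 2) * w (y₀ t)) * yb t
      - θs ^ 2 * l (y₀ t) * m (y₀ t) / 8
      + θs * p₀ t ^ 2 * l (y₀ t) * m (y₀ t) / (4 * w (y₀ t)) := by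
  have hw0 : ∀ s, w (y₀ s) ≠ 0 := fun s => (h.w_pos _).ne'
  obtain ⟨cw, cl, cm, cm'⟩ := h.contDiff_one
  have hasDerivAt_m : ∀ x, HasDerivAt m (deriv m x) x := fun x =>
    (h.contDiff_m.differentiable two_ne_zero x).hasDerivAt
  generalize deriv m = m' at cm' hasDerivAt_m
  have cy := h.contDiff_y₀
  have cp := h.contDiff_p₀
  have cφb := h.contDiff_φb
  have cθb := h.contDiff_θb
  have cyb := h.contDiff_yb
  set g : ℝ → ℝ := fun s => -(l (y₀ s) * w (y₀ s) * θb s)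
      - θs * ((m (y₀ s) + l (y₀ s) ^ 2) * w (y₀ s)) * yb s
      - θs ^ 2 * l (y₀ s) * m (y₀ s) / 8
      + θs * p₀ s ^ 2 * l (y₀ s) * m (y₀ s) / (4 * w (y₀ s)) with hg_def
  set α : ℝ → ℝ := fun s => (θs ^ 2 * l (y₀ s) * (m (y₀ s) + l (y₀ s) ^ 2) / 4
    - l (y₀ s) * (θs ^ 2 * l (y₀ s) ^ 2 / 4
      - θs * p₀ s ^ 2 * (m (y₀ s) - l (y₀ s) ^ 2) / (4 * w (y₀ s))
      - θs * p₀ s * l (y₀ s) * φb s)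
    + θs ^ 2 * l (y₀ s) * m (y₀ s) / 4
    - θs * p₀ s ^ 2 * (m' (y₀ s) - m (y₀ s) * l (y₀ s)) / (4 * w (y₀ s))
    + θs * p₀ s ^ 2 * (2 * l (y₀ s) * m (y₀ s) - l (y₀ s) ^ 3) / (4 * w (y₀ s))
    - θs ^ 2 * l (y₀ s) ^ 3 / 4) / w (y₀ s) with hα_def
  set β : ℝ → ℝ := fun s => (θs ^ 2 * l (y₀ s) * m (y₀ s) / 8
    - θs ^ 2 * l (y₀ s) ^ 3 / 16) / w (y₀ s) with hβ_def
  have hg : ContDiff ℝ 1 g := by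
    simp only [hg_def, div_eq_mul_inv, mul_inv]
    fun_prop (disch := exact hw0)
  have hα : ContDiff ℝ 1 α := by
    simp only [hα_def, div_eq_mul_inv, mul_inv]
    fun_prop (disch := exact hw0)
  have hβ : ContDiff ℝ 1 β := by
    simp only [hβ_def, div_eq_mul_inv]
    fun_prop (disch := exact hw0)
  refine deriv_limit_eq_average h.T_pos h.deriv_φ₀ hg.continuous hα hβ
    (h.contDiff_pb.differentiable one_ne_zero)
    (X := fun ε s => (p ε s - p₀ s) / ε ^ 2
      - θ ε s * p ε s * (m (y ε s) / w (y ε s)) * Real.cos (2 * φ ε s / ε) / 4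
      + l (y₀ s) ^ 2 / w (y₀ s) * (θs / 4 * p₀ s) * Real.cos (2 * φ₀ s / ε))
    (X' := fun ε s => (deriv (p ε) s - -(θs * (l (y₀ s) * w (y₀ s)))) / ε ^ 2
      - (((deriv (θ ε) s * p ε s + θ ε s * deriv (p ε) s) * (m (y ε s) / w (y ε s))
          + θ ε s * p ε s * ((m' (y ε s) - m (y ε s) * l (y ε s)) / w (y ε s) * deriv (y ε) s))
          * Real.cos (2 * φ ε s / ε)
        + θ ε s * p ε s * (m (y ε s) / w (y ε s))
          * (-Real.sin (2 * φ ε s / ε) * (2 * deriv (φ ε) s / ε))) / 4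
      + (((2 * l (y₀ s) * m (y₀ s) - l (y₀ s) ^ 2 * l (y₀ s)) / w (y₀ s) * p₀ s
            * (θs / 4 * p₀ s)
          + l (y₀ s) ^ 2 / w (y₀ s) * (θs / 4 * -(θs * (l (y₀ s) * w (y₀ s)))))
          * Real.cos (2 * φ₀ s / ε)
        + l (y₀ s) ^ 2 / w (y₀ s) * (θs / 4 * p₀ s)
          * (-Real.sin (2 * φ₀ s / ε) * (2 * w (y₀ s) / ε)))) ?_ ?_ ?_ ht
  · intro ε hε s hs
    obtain ⟨-, dθ, dy, dp⟩ := h.differentiable ε hε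
    have hl2 : HasDerivAt (fun x => l x ^ 2) (2 * l (y₀ s) * m (y₀ s)) (y₀ s) := by
      simpa using (h.hasDerivAt_l (y₀ s)).fun_pow 2
    exact ((((dp s).hasDerivAt.sub (h.deriv_p₀ s hs)).div_const _).sub
      (((((dθ s).hasDerivAt.mul (dp s).hasDerivAt).mul
        ((h.hasDerivAt_div_w (hasDerivAt_m (y ε s))).comp s
        (dy s).hasDerivAt)).mul (h.hasDerivAt_phase hε s).cos).div_const 4)).add
      ((((h.hasDerivAt_div_w hl2).comp s (h.deriv_y₀ s hs)).mul
        ((h.deriv_p₀ s hs).const_mul (θs / 4))).mul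
        (((h.deriv_φ₀ s hs).const_mul 2).div_const ε).cos)
  · refine tendsto_iff_ultrafilter _ _ _ |>.2 fun U hU => ?_
    obtain ⟨hev, t, ht, S, C, Φ, Y, P, Θ, L⟩ := h.exists_limits hU
    obtain ⟨Lθ', Ly', Lp'⟩ := h.tendsto_deriv hev L
    have lw := (cw.continuous.tendsto _).comp L.lim_y
    have ll := (cl.continuous.tendsto _).comp L.lim_y
    have lm := (cm.continuous.tendsto _).comp L.lim_y
    have lm' := (cm'.continuous.tendsto _).comp L.lim_y
    have lw₀ := ((cw.comp cy).continuous.tendsto t).comp L.time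
    have ll₀ := ((cl.comp cy).continuous.tendsto t).comp L.time
    have lm₀ := ((cm.comp cy).continuous.tendsto t).comp L.time
    have lp₀ := (cp.continuous.tendsto t).comp L.time
    have lg := (hg.continuous.tendsto t).comp L.time
    have lα := (hα.continuous.tendsto t).comp L.time
    have lβ := (hβ.continuous.tendsto t).comp L.time
    have hlw := L.tendsto_comp_y cy.continuous
      ((h.hasStrictDerivAt_l (y₀ t)).mul (h.hasStrictDerivAt_w (y₀ t)))
    have ln := lm.div lw (hw0 t)
    have h1 := ((((((hlw.const_mul (-θs)).sub (L.res_θ.mul (ll.mul lw))).add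
      ((L.scale.mul ((((lp₀.const_mul θs).mul ll₀).div (lw₀.const_mul 2)
        (mul_ne_zero two_ne_zero (hw0 t))).mul L.sin₀)).mul hlw)).sub
      (((((L.lim_θ.pow 2).mul ll).mul lm).div_const 4).mul (L.sin.pow 2))).sub
      ((((((Lθ'.mul L.lim_p).add (L.lim_θ.mul Lp')).mul ln).add
        ((L.lim_θ.mul L.lim_p).mul (((lm'.sub (lm.mul ll)).div lw (hw0 t)).mul Ly'))).mul
        L.cos).div_const 4)).add
      (((L.lim_θ.mul L.lim_p).mul ln).mul ((((L.lim_p.mul ll).div_const 4).mul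
        (L.sin.pow 2)).add
      (L.scale.mul (((L.lim_θ.mul (ll.pow 2)).div_const 8).mul (L.sin.pow 3)))))).add
      ((((((((ll₀.const_mul 2).mul lm₀).sub ((ll₀.pow 2).mul ll₀)).div lw₀ (hw0 t)).mul lp₀).mul
        (lp₀.const_mul (θs / 4))).add (((ll₀.pow 2).div lw₀ (hw0 t)).mul
        (((ll₀.mul lw₀).const_mul θs).neg.const_mul (θs / 4)))).mul L.cos₀) |>.sub
      ((lg.add ((lw₀.mul lα).mul L.cos₀)).add
        ((lw₀.mul lβ).mul ((L.cos₀.pow 2).sub (L.sin₀.pow 2))))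
    refine tendsto_of_congr_of_eq h1 ?_ ?_
    · filter_upwards [hev] with q hq
      have hε := hq.1.ne'
      have hw := (h.w_pos (y q.1 q.2)).ne'
      have hw₀ := hw0 q.2
      simp only [Function.comp, Pi.div_apply, Pi.mul_apply]
      nth_rw 2 [h.deriv_p q.1 hq.1 q.2 hq.2]
      rw [h.deriv_φ q.1 hq.1 q.2 hq.2]
      field_simp
      ring
    · have hw := hw0 t
      simp only [hg_def, hα_def, hβ_def, L.eq_Y, L.eq_Θ, Function.comp]
      linear_combination (norm := (field_simp; ring))
        (θs * p₀ t ^ 2 * l (y₀ t) * m (y₀ t) / (4 * w (y₀ t))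
          - θs ^ 2 * l (y₀ t) * m (y₀ t) / 8) * L.sq_add_sq
  · refine tendsto_iff_ultrafilter _ _ _ |>.2 fun U hU => ?_
    obtain ⟨hev, t, ht, S, C, Φ, Y, P, Θ, L⟩ := h.exists_limits hU
    have lw := (cw.continuous.tendsto _).comp L.lim_y
    have lm := (cm.continuous.tendsto _).comp L.lim_y
    have lw₀ := ((cw.comp cy).continuous.tendsto t).comp L.time
    have ll₀ := ((cl.comp cy).continuous.tendsto t).comp L.time
    have lp₀ := (cp.continuous.tendsto t).comp L.time
    have h1 := ((L.res_p.sub ((((L.lim_θ.mul L.lim_p).mul (lm.div lw (hw0 t))).mul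
      L.cos).div_const 4)).add ((((ll₀.pow 2).div lw₀ (hw0 t)).mul
        (lp₀.const_mul (θs / 4))).mul L.cos₀)).sub
      ((h.contDiff_pb.continuous.tendsto t).comp L.time)
    refine tendsto_of_congr_of_eq h1 (Eventually.of_forall fun q => rfl) ?_
    have hw := hw0 t
    simp only [L.eq_P, Function.comp]
    field_simp
    ring

/-- The action-angle transformation is canonical: the transformed energy is conserved. -/
theorem energy_eq (h : SlowFastExpansion T θs w l m φ θ y p φ₀ y₀ p₀ φb θb yb pb)
    {ε : ℝ} (hε : 0 < ε) {t : ℝ} (ht : t ∈ Icc 0 T) :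
    (p ε t + ε / 2 * (θ ε t * l (y ε t) * Real.sin (2 * φ ε t / ε))) ^ 2 / 2
      + θ ε t * w (y ε t) = p₀ t ^ 2 / 2 + θs * w (y₀ t) := by
  set E : ℝ → ℝ := fun s =>
    ((p ε s + ε / 2 * (θ ε s * l (y ε s) * Real.sin (2 * φ ε s / ε))) ^ 2 / 2
      + θ ε s * w (y ε s)) - (p₀ s ^ 2 / 2 + θs * w (y₀ s)) with hE
  obtain ⟨-, dθ, dy, dp⟩ := h.differentiable ε hε
  have hder : ∀ s ∈ Icc 0 T, HasDerivAt E 0 s := by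
    intro s hs
    have h1 := ((((dp s).hasDerivAt.add ((((dθ s).hasDerivAt.mul
      ((h.hasDerivAt_l (y ε s)).comp s (dy s).hasDerivAt)).mul
        (h.hasDerivAt_phase hε s).sin).const_mul (ε / 2))).fun_pow 2).div_const 2).add
      ((dθ s).hasDerivAt.mul ((h.hasDerivAt_w (y ε s)).comp s (dy s).hasDerivAt))
    have h2 := (((h.deriv_p₀ s hs).fun_pow 2).div_const 2).add
      (((h.hasDerivAt_w (y₀ s)).comp s (h.deriv_y₀ s hs)).const_mul θs)
    refine (h1.sub h2).congr_deriv ?_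
    simp only [Function.comp, Pi.mul_apply, Pi.add_apply]
    rw [h.deriv_φ ε hε s hs, h.deriv_θ ε hε s hs, h.deriv_y ε hε s hs, h.deriv_p ε hε s hs]
    have := hε.ne'
    field_simp
    ring
  have hconst := (convex_Icc 0 T).is_const_of_fderivWithin_eq_zero (𝕜 := ℝ) (f := E)
    (fun s hs => (hder s hs).differentiableAt.differentiableWithinAt)
    (fun s hs => by
      rw [(hder s hs).hasDerivWithinAt.hasFDerivWithinAt.fderivWithin
        (uniqueDiffOn_Icc h.T_pos s hs)]
      simp)
    (left_mem_Icc.2 h.T_pos.le) ht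
  obtain ⟨i1, i2, i3, i4⟩ := h.initial ε hε
  simp only [hE, i1, i2, i3, i4] at hconst
  simp only [mul_zero, zero_div, Real.sin_zero, add_zero, sub_self] at hconst
  linarith

theorem w_mul_θb (h : SlowFastExpansion T θs w l m φ θ y p φ₀ y₀ p₀ φb θb yb pb)
    {t : ℝ} (ht : t ∈ Icc 0 T) :
    w (y₀ t) * θb t = -(θs * (l (y₀ t) * w (y₀ t)) * yb t) - p₀ t * pb t
      + θs * p₀ t ^ 2 * l (y₀ t) ^ 2 / (4 * w (y₀ t)) - θs ^ 2 * l (y₀ t) ^ 2 / 16 := by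
  set F : Filter (ℝ × ℝ) := 𝓝[>] (0 : ℝ) ×ˢ pure t with hF
  have hFle : (Ultrafilter.of F : Filter (ℝ × ℝ)) ≤ F := Ultrafilter.of_le F
  have hU : (Ultrafilter.of F : Filter (ℝ × ℝ)) ≤ fastLimit T :=
    hFle.trans (prod_mono le_rfl (by simpa using ht))
  obtain ⟨hev, t', -, S, C, Φ, Y, P, Θ, L⟩ := h.exists_limits hU
  obtain rfl : t' = t := tendsto_nhds_unique L.time
    ((tendsto_snd.mono_left hFle).mono_right (pure_le_nhds t))
  have hw := (h.w_pos (y₀ t')).ne'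
  obtain ⟨cw, cl, -, -⟩ := h.contDiff_one
  have cy := h.contDiff_y₀
  have lw := (cw.continuous.tendsto _).comp L.lim_y
  have ll := (cl.continuous.tendsto _).comp L.lim_y
  have lw₀ := ((cw.comp cy).continuous.tendsto t').comp L.time
  have ll₀ := ((cl.comp cy).continuous.tendsto t').comp L.time
  have lp₀ := (h.contDiff_p₀.continuous.tendsto t').comp L.time
  have hΔw := L.tendsto_comp_y cy.continuous (h.hasStrictDerivAt_w (y₀ t'))
  have hΔl := L.tendsto_comp_y cy.continuous (h.hasStrictDerivAt_l (y₀ t'))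
  have lA := (((lp₀.const_mul θs).mul ll₀).div (lw₀.const_mul 2)
    (mul_ne_zero two_ne_zero hw)).mul L.sin₀
  have h1 := ((((((lw.mul L.res_θ).add (hΔw.const_mul θs)).add
    (((L.lim_p.add lp₀).mul L.res_p).div_const 2)).add
    ((((L.lim_θ.pow 2).mul (ll.pow 2)).mul (L.sin.pow 2)).div_const 8)).add
    ((((L.lim_p.mul L.lim_θ).mul ll).mul L.sin_sub).div_const 2)).add
    ((L.sin₀.div_const 2).mul ((((L.scale.mul ((L.res_p.mul L.lim_θ).mul ll)).add
      ((lp₀.mul ll).mul ((L.scale.mul L.res_θ).sub lA))).add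
      (((lp₀.const_mul θs).mul (L.scale.mul hΔl))))))).sub
    ((L.scale.mul hΔw).mul lA)
  have h2 := tendsto_nhds_unique h1 (tendsto_const_nhds (x := (0 : ℝ)) |>.congr' ?_)
  · simp only [Function.comp, L.eq_Y, L.eq_P, L.eq_Θ, L.eq_Φ] at h2
    linear_combination (norm := (field_simp; ring)) h2
      + (θs * p₀ t' ^ 2 * l (y₀ t') ^ 2 / (4 * w (y₀ t')) - θs ^ 2 * l (y₀ t') ^ 2 / 16)
        * L.sq_add_sq
  · filter_upwards [hev] with q hq
    have hε := hq.1.ne'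
    have hw := (h.w_pos (y₀ q.2)).ne'
    simp only [Function.comp, Pi.div_apply]
    linear_combination (norm := (field_simp; ring))
      (-1 / q.1 ^ 2) * h.energy_eq hq.1 hq.2

theorem deriv_θb (h : SlowFastExpansion T θs w l m φ θ y p φ₀ y₀ p₀ φb θb yb pb)
    {t : ℝ} (ht : t ∈ Icc 0 T) :
    deriv θb t = deriv (fun s => θs * (p₀ s * l (y₀ s)) ^ 2 / (8 * w (y₀ s) ^ 2)) t := by
  have hw0 : ∀ s, w (y₀ s) ≠ 0 := fun s => (h.w_pos _).ne'
  have hw := hw0 t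
  have dl := (h.hasDerivAt_l (y₀ t)).comp t (h.deriv_y₀ t ht)
  have dw := (h.hasDerivAt_w (y₀ t)).comp t (h.deriv_y₀ t ht)
  have dp := h.deriv_p₀ t ht
  have dyb := (h.contDiff_yb.differentiable one_ne_zero t).hasDerivAt
  have dpb := (h.contDiff_pb.differentiable one_ne_zero t).hasDerivAt
  have hR := (((dp.mul dl).fun_pow 2).const_mul θs).div ((dw.fun_pow 2).const_mul 8)
    (mul_ne_zero (by norm_num) (pow_ne_zero 2 hw))
  have hθ := (((dl.mul dyb).const_mul (-θs)).sub ((dp.mul dpb).div dw hw)).add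
    (((((dp.mul dl).fun_pow 2).const_mul θs).div ((dw.fun_pow 2).const_mul 4)
      (mul_ne_zero (by norm_num) (pow_ne_zero 2 hw))).sub
    (((dl.fun_pow 2).const_mul (θs ^ 2)).div (dw.const_mul 16)
      (mul_ne_zero (by norm_num) hw)))
  refine (deriv_eq_of_hasDerivAt_of_eqOn_Icc h.T_pos
    (h.contDiff_θb.differentiable one_ne_zero t) hθ (c := 0) (fun s hs => ?_) ht).trans ?_
  · have hws := hw0 s
    have h1 := h.w_mul_θb hs
    simp only [Function.comp, Pi.mul_apply, Pi.add_apply, Pi.sub_apply, Pi.div_apply]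
    refine mul_left_cancel₀ hws (h1.trans ?_)
    field_simp
    ring
  · refine Eq.trans ?_ hR.deriv.symm
    simp only [Function.comp, Pi.mul_apply]
    rw [h.deriv_yb ht, h.deriv_pb ht]
    linear_combination (norm := (field_simp; ring)) (p₀ t * l (y₀ t) / w (y₀ t)) * h.w_mul_θb ht

end SlowFastExpansion

/-- The weak* limits `(φ̄₂, θ̄₂, ȳ₂, p̄₂)` of the second-order
residuals (obtained as uniform limits of the residuals minus their oscillatory
parts) satisfy the inhomogeneous linear ODE system of Theorem 2. -/
theorem stmt12 (T : ℝ) (hT : 0 < T)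
    (ω : ℝ → ℝ) (hω : ContDiff ℝ (⊤ : ℕ∞) ω)
    (ωs : ℝ) (hωs : 0 < ωs) (hωlb : ∀ x, ωs ≤ ω x)
    (φ θ y p : ℝ → ℝ → ℝ)
    (hreg : ∀ ε > (0:ℝ), ContDiff ℝ 1 (φ ε) ∧ ContDiff ℝ 1 (θ ε) ∧
      ContDiff ℝ 1 (y ε) ∧ ContDiff ℝ 1 (p ε))
    (ys ps us θs : ℝ) (hθs : θs = us ^ 2 / (2 * ω ys))
    (hinit : ∀ ε > (0:ℝ), φ ε 0 = 0 ∧ θ ε 0 = θs ∧ y ε 0 = ys ∧ p ε 0 = ps)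
    (hφode : ∀ ε > (0:ℝ), ∀ t ∈ Icc (0:ℝ) T,
      deriv (φ ε) t = ω (y ε t)
        + ε * (p ε t * deriv ω (y ε t) / (2 * ω (y ε t))) * Real.sin (2 * φ ε t / ε)
        + ε ^ 2 * (θ ε t * (deriv ω (y ε t)) ^ 2 / (4 * (ω (y ε t)) ^ 2))
            * (Real.sin (2 * φ ε t / ε)) ^ 2)
    (hθode : ∀ ε > (0:ℝ), ∀ t ∈ Icc (0:ℝ) T,
      deriv (θ ε) t
        = -(θ ε t * p ε t * deriv ω (y ε t) / ω (y ε t)) * Real.cos (2 * φ ε t / ε)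
          - ε * ((θ ε t) ^ 2 * (deriv ω (y ε t)) ^ 2 / (4 * (ω (y ε t)) ^ 2))
              * Real.sin (4 * φ ε t / ε))
    (hyode : ∀ ε > (0:ℝ), ∀ t ∈ Icc (0:ℝ) T,
      deriv (y ε) t = p ε t
        + ε * (θ ε t * deriv ω (y ε t) / (2 * ω (y ε t))) * Real.sin (2 * φ ε t / ε))
    (hpode : ∀ ε > (0:ℝ), ∀ t ∈ Icc (0:ℝ) T,
      deriv (p ε) t = -(θ ε t * deriv ω (y ε t))
        + ε * (θ ε t * p ε t * (deriv ω (y ε t)) ^ 2 / (2 * (ω (y ε t)) ^ 2))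
            * Real.sin (2 * φ ε t / ε)
        - ε * (θ ε t * p ε t * deriv (deriv ω) (y ε t) / (2 * ω (y ε t)))
            * Real.sin (2 * φ ε t / ε)
        + ε ^ 2 * ((θ ε t) ^ 2 * (deriv ω (y ε t)) ^ 3 / (4 * (ω (y ε t)) ^ 3))
            * (Real.sin (2 * φ ε t / ε)) ^ 2
        - ε ^ 2 * ((θ ε t) ^ 2 * deriv ω (y ε t) * deriv (deriv ω) (y ε t)
              / (4 * (ω (y ε t)) ^ 2))
            * (Real.sin (2 * φ ε t / ε)) ^ 2)
    (φ₀ y₀ p₀ : ℝ → ℝ)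
    (hlimreg : ContDiff ℝ 1 φ₀ ∧ ContDiff ℝ 1 y₀ ∧ ContDiff ℝ 1 p₀)
    (hliminit : φ₀ 0 = 0 ∧ y₀ 0 = ys ∧ p₀ 0 = ps)
    (hlimode : ∀ t ∈ Icc (0:ℝ) T,
      deriv φ₀ t = ω (y₀ t) ∧ deriv y₀ t = p₀ t ∧
      deriv p₀ t = -(θs * deriv ω (y₀ t)))
    (hconv_y : TendstoUniformlyOn (fun ε t => y ε t) y₀ (𝓝[>] (0:ℝ)) (Icc 0 T))
    (hconv_p : TendstoUniformlyOn (fun ε t => p ε t) p₀ (𝓝[>] (0:ℝ)) (Icc 0 T))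
    (hconv_θ : TendstoUniformlyOn (fun ε t => θ ε t) (fun _ => θs) (𝓝[>] (0:ℝ)) (Icc 0 T))
    (hconv_φ : TendstoUniformlyOn (fun ε t => φ ε t) φ₀ (𝓝[>] (0:ℝ)) (Icc 0 T))
    (φbar2 θbar2 ybar2 pbar2 : ℝ → ℝ)
    (hbarreg : ContDiff ℝ 1 φbar2 ∧ ContDiff ℝ 1 θbar2 ∧
      ContDiff ℝ 1 ybar2 ∧ ContDiff ℝ 1 pbar2)
    (hφ2conv : TendstoUniformlyOn
      (fun ε t => (φ ε t - φ₀ t) / ε ^ 2 - oscφ2 ω y₀ p₀ φ₀ ε t)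
      φbar2 (𝓝[>] (0:ℝ)) (Icc 0 T))
    (hy2conv : TendstoUniformlyOn
      (fun ε t => (y ε t - y₀ t) / ε ^ 2 - oscy2 ω y₀ φ₀ θs ε t)
      ybar2 (𝓝[>] (0:ℝ)) (Icc 0 T))
    (hp2conv : TendstoUniformlyOn
      (fun ε t => (p ε t - p₀ t) / ε ^ 2 - oscp2 ω y₀ φ₀ θs ε t)
      pbar2 (𝓝[>] (0:ℝ)) (Icc 0 T))
    (hθ2conv : TendstoUniformlyOn
      (fun ε t => ((θ ε t - θs) / ε - oscθ1 ω y₀ p₀ φ₀ θs ε t) / ε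
        - oscθ2 ω y₀ p₀ φ₀ φbar2 θs ε t)
      θbar2 (𝓝[>] (0:ℝ)) (Icc 0 T)) :
    ∀ t ∈ Icc (0:ℝ) T,
      deriv φbar2 t = deriv ω (y₀ t) * ybar2 t
          + θs * (DyL ω y₀ t) ^ 2 / 8
          - (DtL ω y₀ p₀ t) ^ 2 / (8 * ω (y₀ t)) ∧
      deriv θbar2 t
        = deriv (fun s => θs * (DtL ω y₀ p₀ s) ^ 2 / (8 * (ω (y₀ s)) ^ 2)) t ∧
      deriv ybar2 t
        = pbar2 t - θs * DyL ω y₀ t * DtL ω y₀ p₀ t / (4 * ω (y₀ t)) ∧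
      deriv pbar2 t
        = -(deriv ω (y₀ t)) * θbar2 t - θs * deriv (deriv ω) (y₀ t) * ybar2 t
          - θs ^ 2 * DyL ω y₀ t * Dy2L ω y₀ t / 8
          + θs * DtL ω y₀ p₀ t * DtDyL ω y₀ t / (4 * ω (y₀ t)) := by
  have hω0 : ∀ x, 0 < ω x := fun x => hωs.trans_le (hωlb x)
  have cdω : ContDiff ℝ (⊤ : ℕ∞) (deriv ω) := (contDiff_infty_iff_deriv.1 hω).2
  obtain ⟨l, hl⟩ : ∃ l : ℝ → ℝ, l = fun x => deriv ω x / ω x := ⟨_, rfl⟩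
  have cl : ContDiff ℝ (⊤ : ℕ∞) l := by
    rw [hl]
    exact cdω.div hω fun x => (hω0 x).ne'
  have hl' : ∀ x, HasDerivAt l (deriv l x) x := fun x =>
    (cl.differentiable (by simp) x).hasDerivAt
  have cm : ContDiff ℝ (⊤ : ℕ∞) (deriv l) := (contDiff_infty_iff_deriv.1 cl).2
  generalize deriv l = m at hl' cm
  have hω1 : deriv ω = fun x => l x * ω x := by
    funext x
    rw [hl, div_mul_cancel₀ _ (hω0 x).ne']
  have hω' : ∀ x, HasDerivAt ω (l x * ω x) x := fun x => by
    simpa only [hω1] using (hω.differentiable (by simp) x).hasDerivAt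
  have hω2 : deriv (deriv ω) = fun x => (m x + l x ^ 2) * ω x := by
    funext x
    rw [hω1]
    refine ((hl' x).mul (hω' x)).deriv.trans ?_
    ring
  have hDy : ∀ t, DyL ω y₀ t = l (y₀ t) := fun t => by rw [DyL, hl]
  have hDt : ∀ t, DtL ω y₀ p₀ t = p₀ t * l (y₀ t) := fun t => by rw [DtL, hl]; ring
  obtain ⟨cφ₀, cy₀, cp₀⟩ := hlimreg
  have dy₀ : ∀ t ∈ Icc 0 T, HasDerivAt y₀ (p₀ t) t := fun t ht => by
    simpa only [(hlimode t ht).2.1] using (cy₀.differentiable one_ne_zero t).hasDerivAt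
  have hoscp : ∀ ε, ∀ t ∈ Icc 0 T, oscp2 ω y₀ φ₀ θs ε t =
      θs * p₀ t * (m (y₀ t) - l (y₀ t) ^ 2) / (4 * ω (y₀ t)) * Real.cos (2 * φ₀ t / ε) := by
    intro ε t ht
    have hw := (hω0 (y₀ t)).ne'
    rw [oscp2]
    congr 1
    simp only [hDy]
    refine ((((hl' (y₀ t)).comp t (dy₀ t ht)).const_mul θs).div
      (((hω' (y₀ t)).comp t (dy₀ t ht)).const_mul 4)
      (mul_ne_zero four_ne_zero hw)).deriv.trans ?_
    simp only [Function.comp]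
    field_simp
  have cos_four : ∀ t ε, Real.cos (4 * φ₀ t / ε)
      = Real.cos (2 * φ₀ t / ε) ^ 2 - Real.sin (2 * φ₀ t / ε) ^ 2 := fun t ε => by
    rw [← Real.cos_two_mul']
    congr 1
    ring
  have hIcc : ∀ᶠ q in fastLimit T, q.2 ∈ Icc 0 T := tendsto_principal.1 tendsto_snd
  have h : SlowFastExpansion T θs ω l m φ θ y p φ₀ y₀ p₀ φbar2 θbar2 ybar2 pbar2 :=
    { T_pos := hT
      w_pos := hω0
      hasDerivAt_w := hω'
      hasDerivAt_l := hl'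
      contDiff_w := contDiff_infty.1 hω 2
      contDiff_l := contDiff_infty.1 cl 2
      contDiff_m := contDiff_infty.1 cm 2
      differentiable := fun ε hε => by
        obtain ⟨h1, h2, h3, h4⟩ := hreg ε hε
        exact ⟨h1.differentiable one_ne_zero, h2.differentiable one_ne_zero,
          h3.differentiable one_ne_zero, h4.differentiable one_ne_zero⟩
      deriv_φ := fun ε hε s hs => by
        have hw := (hω0 (y ε s)).ne'
        rw [hφode ε hε s hs]
        simp only [hω1]
        field_simp
      deriv_θ := fun ε hε s hs => by
        have hw := (hω0 (y ε s)).ne'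
        have h4 : Real.sin (4 * φ ε s / ε)
            = 2 * Real.sin (2 * φ ε s / ε) * Real.cos (2 * φ ε s / ε) := by
          rw [← Real.sin_two_mul]
          congr 1
          ring
        rw [hθode ε hε s hs, h4]
        simp only [hω1]
        field_simp
        ring
      deriv_y := fun ε hε s hs => by
        have hw := (hω0 (y ε s)).ne'
        rw [hyode ε hε s hs]
        simp only [hω1]
        field_simp
      deriv_p := fun ε hε s hs => by
        have hw := (hω0 (y ε s)).ne'
        rw [hpode ε hε s hs, hω2]
        simp only [hω1]
        field_simp
        ring
      initial := fun ε hε => by simpa only [hliminit] using hinit ε hε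
      contDiff_φ₀ := cφ₀
      contDiff_y₀ := cy₀
      contDiff_p₀ := cp₀
      deriv_φ₀ := fun s hs => by
        simpa only [(hlimode s hs).1] using (cφ₀.differentiable one_ne_zero s).hasDerivAt
      deriv_y₀ := dy₀
      deriv_p₀ := fun s hs => by
        simpa only [(hlimode s hs).2.2, hω1] using (cp₀.differentiable one_ne_zero s).hasDerivAt
      contDiff_φb := hbarreg.1
      contDiff_θb := hbarreg.2.1
      contDiff_yb := hbarreg.2.2.1
      contDiff_pb := hbarreg.2.2.2
      residual_φ := hφ2conv.tendsto_fastLimit.congr fun q => by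
        simp only [oscφ2, hDt]
        ring
      residual_y := hy2conv.tendsto_fastLimit.congr fun q => by
        simp only [oscy2, hDy]
        ring
      residual_p := hp2conv.tendsto_fastLimit.congr' <| hIcc.mono fun q hq => by
        simp only [hoscp q.1 q.2 hq]
      residual_θ := hθ2conv.tendsto_fastLimit.congr' <| hIcc.mono fun q hq => by
        simp only [oscθ1, oscθ2, oscy2, hoscp q.1 q.2 hq, hDy, hDt, cos_four]
        ring }
  intro t ht
  have hw := (hω0 (y₀ t)).ne'
  have hDy2 : Dy2L ω y₀ t = m (y₀ t) := by
    rw [Dy2L, hω2]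
    simp only [hω1]
    field_simp
    ring
  have hDtDy : DtDyL ω y₀ t = m (y₀ t) * p₀ t := by
    refine Eq.trans ?_ ((hl' (y₀ t)).comp t (dy₀ t ht)).deriv
    rw [DtDyL, hl]
    rfl
  rw [hDy2, hDtDy, hω2, hω1]
  simp only [hDy, hDt]
  refine ⟨h.deriv_φb ht, h.deriv_θb ht, (h.deriv_yb ht).trans ?_, (h.deriv_pb ht).trans ?_⟩
  · ring
  · ring
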